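/- Let X and A be finite nonempty alphabets with A ⊆ X, let n ≥ 1, and let x_{1:n} ∈ A^n. Then ξ(x_{1:n}) ≥ n^{−1} · |X|^{−|A|} · ρ_A(x_{1:n}), where ξ is the Sparse Sequential Dirichlet distribution over X and ρ_A is the Sequential Dirichlet estimator over A. -/

import Mathlib

open Finset

/-- `cnt x i` is the number of occurrences of the symbol `x i` among `x 1, …, x (i-1)`,
i.e. the count `c(x_{1:i})` from the paper. -/
def cnt {σ : Type*} [DecidableEq σ] (x : ℕ → σ) (i : ℕ) : ℕ :=
  ((Finset.Ico 1 i).filter (fun j => x j = x i)).card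

/-- `seen x i` is the set `U(x_{<i})` of distinct symbols occurring in `x 1, …, x (i-1)`. -/
def seen {σ : Type*} [DecidableEq σ] (x : ℕ → σ) (i : ℕ) : Finset σ :=
  (Finset.Ico 1 i).image x

/-- The Sequential Dirichlet (Krichevsky–Trofimov) estimator over the alphabet `A`:
`ρ_A(x_{1:n}) = ∏_{i=1}^n (c(x_{1:i}) + 1/2) / (i + |A|/2 - 1)`. -/
noncomputable def rho {σ : Type*} [DecidableEq σ] (A : Finset σ) (x : ℕ → σ) (n : ℕ) : ℝ :=
  ∏ i ∈ Finset.Icc 1 n, ((cnt x i : ℝ) + 1/2) / ((i : ℝ) + (A.card : ℝ)/2 - 1)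

/-- The Sparse Sequential Dirichlet distribution over the alphabet `Xs`:
`ξ(x_{1:n}) = ∏_{i=1}^n f_i` where `f_i = (1/i)·(1/(|X| - |U(x_{<i})|))` if `c(x_{1:i}) = 0`
and `f_i = (1 - 1/i)·(c(x_{1:i}) + 1/2)/(i + |U(x_{<i})|/2 - 1)` otherwise. -/
noncomputable def xi {σ : Type*} [DecidableEq σ] (Xs : Finset σ) (x : ℕ → σ) (n : ℕ) : ℝ :=
  ∏ i ∈ Finset.Icc 1 n,
    if cnt x i = 0 then
      (1/(i:ℝ)) * (1/((Xs.card : ℝ) - ((seen x i).card : ℝ)))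
    else
      (1 - 1/(i:ℝ)) * (((cnt x i : ℝ) + 1/2) / ((i:ℝ) + ((seen x i).card : ℝ)/2 - 1))



theorem sd_seen_succ {σ : Type*} [DecidableEq σ] (x : ℕ → σ) (i : ℕ) (hi : 1 ≤ i) :
    seen x (i + 1) = insert (x i) (seen x i) := by
  unfold seen
  rw [← Finset.image_insert]
  congr 1
  ext j
  simp only [Finset.mem_Ico, Finset.mem_insert]
  omega

theorem sd_cnt_zero {σ : Type*} [DecidableEq σ] (x : ℕ → σ) (i : ℕ) :
    cnt x i = 0 ↔ x i ∉ seen x i := by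
  unfold cnt seen
  rw [Finset.card_eq_zero, Finset.filter_eq_empty_iff]
  simp only [Finset.mem_image, not_exists, not_and]

theorem sd_alg1 (P M d n : ℝ) (hn : 1 ≤ n) (hd : 0 < d) :
    P * (M / d) = 1 / (n + 1) * (1 / d) * ((n + 1) * (P * M)) := by
  have : n + 1 ≠ 0 := by linarith
  field_simp

theorem sd_alg2 (n P r : ℝ) (hn : 1 ≤ n) :
    n * P * r = n / (n + 1) * r * ((n + 1) * P) := by
  have : n + 1 ≠ 0 := by linarith
  field_simp

theorem sd_alg3 (n : ℝ) (hn : 1 ≤ n) : 1 - 1 / (n + 1) = n / (n + 1) := by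
  have : n + 1 ≠ 0 := by linarith
  field_simp
  ring

theorem sd_pos (n c u : ℝ) (hn : 1 ≤ n) (hc : 0 ≤ c) (hu : 0 ≤ u) :
    0 ≤ n / (n + 1) * ((c + 1/2) / (n + u/2)) := by
  positivity

theorem sd_mono (n P c u m : ℝ) (hn : 1 ≤ n) (hP : 0 ≤ P) (hc : 0 ≤ c) (hu : 0 ≤ u)
    (hum : u ≤ m) :
    n * P * ((c + 1/2) / (n + m/2)) ≤ n * P * ((c + 1/2) / (n + u/2)) := by
  gcongr

theorem sd_aux {σ : Type*} [DecidableEq σ]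
    (Xs A : Finset σ) (hA : A.Nonempty) (hAX : A ⊆ Xs)
    (n : ℕ) (hn : 1 ≤ n) (x : ℕ → σ) (hx : ∀ i ∈ Finset.Icc 1 n, x i ∈ A) :
    0 ≤ xi Xs x n ∧ 0 ≤ rho A x n ∧ seen x (n + 1) ⊆ A ∧
      rho A x n ≤ xi Xs x n * (n * (Xs.card : ℝ) ^ (seen x (n + 1)).card) := by
  have hm : (1 : ℝ) ≤ A.card := by exact_mod_cast hA.card_pos
  have hM : (A.card : ℝ) ≤ Xs.card := by exact_mod_cast Finset.card_le_card hAX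
  have hM0 : (0 : ℝ) < Xs.card := by linarith
  induction n, hn using Nat.le_induction with
  | base =>
    have h1 : x 1 ∈ A := hx 1 (by simp)
    have hs : seen x (1 + 1) = {x 1} := by
      rw [sd_seen_succ x 1 le_rfl]; simp [seen]
    have hm0 : (0 : ℝ) < A.card := by linarith
    rw [hs]
    have e1 : xi Xs x 1 = 1 / (Xs.card : ℝ) := by simp [xi, cnt, seen]
    have e2 : rho A x 1 = 1 / (A.card : ℝ) := by
      simp [rho, cnt]
      field_simp
    rw [e1, e2]
    refine ⟨by positivity, by positivity, by simpa using h1, ?_⟩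
    have : 1 / (Xs.card : ℝ) * (((1 : ℕ) : ℝ) * (Xs.card : ℝ) ^ ({x 1} : Finset σ).card) = 1 := by
      simp; field_simp
    rw [this, div_le_one hm0]
    exact hm
  | succ n hn ih =>
    obtain ⟨h1, h2, h3, h4⟩ := ih (fun i hi => hx i (by
      simp only [Finset.mem_Icc] at hi ⊢; omega))
    have hxA : x (n + 1) ∈ A := hx (n + 1) (by simp)
    have hnR : (1 : ℝ) ≤ n := by exact_mod_cast hn
    have hss := sd_seen_succ x (n + 1) (by omega)
    have hu : ((seen x (n + 1)).card : ℝ) ≤ A.card := by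
      exact_mod_cast Finset.card_le_card h3
    have hu0 : (0 : ℝ) ≤ (seen x (n + 1)).card := by positivity
    have hc0 : (0 : ℝ) ≤ cnt x (n + 1) := by positivity
    have hrho : rho A x (n + 1) = rho A x n *
        (((cnt x (n + 1) : ℝ) + 1/2) / ((n : ℝ) + (A.card : ℝ)/2)) := by
      unfold rho
      rw [Finset.prod_Icc_succ_top (by omega)]
      push_cast
      congr 2
      ring
    have hr0 : 0 ≤ ((cnt x (n + 1) : ℝ) + 1/2) / ((n : ℝ) + (A.card : ℝ)/2) := by positivity
    -- reduce to a one-step bound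
    suffices H : ∃ f : ℝ, 0 ≤ f ∧ xi Xs x (n + 1) = xi Xs x n * f ∧
        (n * (Xs.card : ℝ) ^ (seen x (n + 1)).card) *
          (((cnt x (n + 1) : ℝ) + 1/2) / ((n : ℝ) + (A.card : ℝ)/2)) ≤
        f * (((n + 1 : ℕ) : ℝ) * (Xs.card : ℝ) ^ (seen x (n + 1 + 1)).card) by
      obtain ⟨f, hf, hxi, hst⟩ := H
      refine ⟨by rw [hxi]; positivity, by rw [hrho]; positivity, ?_, ?_⟩
      · rw [hss]; exact Finset.insert_subset hxA h3
      · rw [hrho, hxi]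
        calc _ ≤ _ := mul_le_mul_of_nonneg_right h4 hr0
          _ = xi Xs x n * ((n * (Xs.card : ℝ) ^ (seen x (n + 1)).card) *
          (((cnt x (n + 1) : ℝ) + 1/2) / ((n : ℝ) + (A.card : ℝ)/2))) := by ring
          _ ≤ _ := mul_le_mul_of_nonneg_left hst h1
          _ = _ := by ring
    by_cases hc : cnt x (n + 1) = 0
    · have hnot := (sd_cnt_zero x (n + 1)).1 hc
      have hcard : (seen x (n + 1 + 1)).card = (seen x (n + 1)).card + 1 := by
        rw [hss, Finset.card_insert_of_notMem hnot]
      have hlt : ((seen x (n + 1)).card : ℝ) + 1 ≤ Xs.card := by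
        have : (seen x (n + 1 + 1)).card ≤ Xs.card := by
          rw [hss]; exact Finset.card_le_card ((Finset.insert_subset hxA h3).trans hAX)
        rw [hcard] at this
        exact_mod_cast this
      refine ⟨(1 / ((n : ℝ) + 1)) * (1 / ((Xs.card : ℝ) - ((seen x (n + 1)).card : ℝ))), ?_, ?_, ?_⟩
      · have : (0 : ℝ) < (Xs.card : ℝ) - ((seen x (n + 1)).card : ℝ) := by linarith
        positivity
      · unfold xi
        rw [Finset.prod_Icc_succ_top (by omega), if_pos hc]
        push_cast
        rfl
      · rw [hcard, hc, pow_succ]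
        set u : ℝ := ((seen x (n + 1)).card : ℝ)
        have hd : (0 : ℝ) < (Xs.card : ℝ) - u := by linarith
        have hP : (0 : ℝ) ≤ (Xs.card : ℝ) ^ (seen x (n + 1)).card := by positivity
        have k1 : (n : ℝ) * ((((0 : ℕ) : ℝ) + 1/2) / ((n : ℝ) + (A.card : ℝ)/2)) ≤ 1 := by
          rw [← mul_div_assoc, div_le_one (by positivity)]
          push_cast
          linarith
        have k2 : 1 ≤ (Xs.card : ℝ) / ((Xs.card : ℝ) - u) := by
          rw [one_le_div hd]; linarith
        calc _ = (Xs.card : ℝ) ^ (seen x (n + 1)).card *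
              ((n : ℝ) * ((((0 : ℕ) : ℝ) + 1/2) / ((n : ℝ) + (A.card : ℝ)/2))) := by ring
          _ ≤ (Xs.card : ℝ) ^ (seen x (n + 1)).card * ((Xs.card : ℝ) / ((Xs.card : ℝ) - u)) :=
            mul_le_mul_of_nonneg_left (k1.trans k2) hP
          _ = _ := by push_cast; exact sd_alg1 _ _ _ _ hnR hd
    · have hin : x (n + 1) ∈ seen x (n + 1) := by
        by_contra h
        exact hc ((sd_cnt_zero x (n + 1)).2 h)
      have hcard : seen x (n + 1 + 1) = seen x (n + 1) := by
        rw [hss, Finset.insert_eq_of_mem hin]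
      refine ⟨(n / ((n : ℝ) + 1)) * (((cnt x (n + 1) : ℝ) + 1/2) /
        ((n : ℝ) + ((seen x (n + 1)).card : ℝ)/2)), sd_pos _ _ _ hnR hc0 hu0, ?_, ?_⟩
      · unfold xi
        rw [Finset.prod_Icc_succ_top (by omega), if_neg hc]
        push_cast
        congr 2
        · exact sd_alg3 _ hnR
        · congr 1; ring
      · rw [hcard]
        calc _ ≤ (n * (Xs.card : ℝ) ^ (seen x (n + 1)).card) *
          (((cnt x (n + 1) : ℝ) + 1/2) / ((n : ℝ) + ((seen x (n + 1)).card : ℝ)/2)) := by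
              exact sd_mono _ _ _ _ _ hnR (pow_nonneg hM0.le _) hc0 hu0 hu
          _ = _ := by push_cast; exact sd_alg2 _ _ _ hnR

/-- For alphabets `A ⊆ X`, `n ≥ 1` and a sequence over `A`, the Sparse Sequential
Dirichlet distribution satisfies `ξ ≥ n⁻¹ · |X|^(-|A|) · ρ_A`. -/
theorem sparse_dirichlet_lower_bound {σ : Type*} [DecidableEq σ]
    (Xs A : Finset σ) (hA : A.Nonempty) (hAX : A ⊆ Xs)
    (n : ℕ) (hn : 1 ≤ n) (x : ℕ → σ) (hx : ∀ i ∈ Finset.Icc 1 n, x i ∈ A) :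
    xi Xs x n ≥ ((n : ℝ))⁻¹ * (((Xs.card : ℝ)) ^ A.card)⁻¹ * rho A x n := by
  obtain ⟨h1, h2, h3, h4⟩ := sd_aux Xs A hA hAX n hn x hx
  have hM : (1 : ℝ) ≤ Xs.card := by exact_mod_cast (hA.mono hAX).card_pos
  have hM0 : (0 : ℝ) < Xs.card := by linarith
  have hn0 : (0 : ℝ) < n := by exact_mod_cast hn
  have hp := pow_le_pow_right₀ hM (Finset.card_le_card h3)
  have h5 : rho A x n ≤ xi Xs x n * (n * (Xs.card : ℝ) ^ A.card) :=
    h4.trans (by gcongr)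
  rw [ge_iff_le, ← mul_inv, inv_mul_le_iff₀ (by positivity)]
  linarith
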